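/- Half-of-best-guess lemma (Lemma 3 of the paper): Let U be a finite type, f : Finset U → ℝ be nonnegative, monotone and submodular, T ≥ 1, and P^1, …, P^T, G^1, …, G^T ⊆ U be sets such that for every t ∈ {1, …, T}, f(P^t | ⋃_{s<t} P^s) ≥ f(G^t | ⋃_{s<t} P^s). Then f(⋃_{t=1}^T P^t) ≥ (1/2) · f(⋃_{t=1}^T G^t). -/

import Mathlib

/-- A set function is submodular if
`f (A ∪ {e}) - f A ≥ f (B ∪ {e}) - f B` for all `A ⊆ B` and `e ∉ B`. -/
def IsSubmodular {U : Type*} [DecidableEq U] (f : Finset U → ℝ) : Prop :=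
  ∀ A B : Finset U, A ⊆ B → ∀ e ∉ B, f (insert e A) - f A ≥ f (insert e B) - f B

/-- A set function is monotone if `f A ≤ f B` whenever `A ⊆ B`. -/
def IsMonotoneFn {U : Type*} [DecidableEq U] (f : Finset U → ℝ) : Prop :=
  ∀ A B : Finset U, A ⊆ B → f A ≤ f B

/-- The marginal gain `f(A | B) = f (A ∪ B) - f B`. -/
def marg {U : Type*} [DecidableEq U] (f : Finset U → ℝ) (A B : Finset U) : ℝ :=
  f (A ∪ B) - f B

/-- The union of the first `n` sets of the family `X` (empty for `n = 0`). -/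
def prefUnion {U : Type*} [DecidableEq U] {T : ℕ} (X : Fin T → Finset U) (n : ℕ) :
    Finset U :=
  (Finset.univ.filter (fun s : Fin T => (s : ℕ) < n)).biUnion X

/-- Marginal gains of a monotone submodular function decrease as the base set grows. -/
theorem marg_anti {U : Type*} [DecidableEq U] {f : Finset U → ℝ}
    (hmono : IsMonotoneFn f) (hsub : IsSubmodular f) (C : Finset U) {A B : Finset U}
    (hAB : A ⊆ B) : marg f C B ≤ marg f C A := by
  unfold marg
  induction C using Finset.induction_on with
  | empty => simp
  | insert e C _ ih =>
    rw [Finset.insert_union, Finset.insert_union]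
    by_cases he : e ∈ C ∪ B
    · rw [Finset.insert_eq_of_mem he]
      linarith [hmono _ _ (Finset.subset_insert e (C ∪ A))]
    · linarith [hsub _ _ (Finset.union_subset_union_right hAB : C ∪ A ⊆ C ∪ B) e he]

theorem prefUnion_zero {U : Type*} [DecidableEq U] {T : ℕ} (X : Fin T → Finset U) :
    prefUnion X 0 = ∅ := by
  simp [prefUnion]

theorem prefUnion_eq_biUnion_univ {U : Type*} [DecidableEq U] {T : ℕ}
    (X : Fin T → Finset U) : prefUnion X T = Finset.univ.biUnion X := by
  simp [prefUnion]

theorem prefUnion_succ {U : Type*} [DecidableEq U] {T : ℕ} (X : Fin T → Finset U)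
    (t : Fin T) : prefUnion X (t + 1) = X t ∪ prefUnion X t := by
  have h : Finset.univ.filter (fun s : Fin T => (s : ℕ) < t + 1) =
      insert t (Finset.univ.filter (fun s : Fin T => (s : ℕ) < t)) := by
    ext s
    simp only [Finset.mem_filter, Finset.mem_univ, true_and, Finset.mem_insert, Fin.ext_iff]
    omega
  rw [prefUnion, h, Finset.biUnion_insert, prefUnion]

theorem prefUnion_subset_biUnion_univ {U : Type*} [DecidableEq U] {T : ℕ}
    (X : Fin T → Finset U) (n : ℕ) : prefUnion X n ⊆ Finset.univ.biUnion X :=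
  Finset.biUnion_subset_biUnion_of_subset_left X (Finset.filter_subset _ _)

/-- The gain of adding the first `n` guesses to any set containing all selected sets is at most
the gain of the first `n` selected sets over the empty set. -/
theorem marg_prefUnion_le {U : Type*} [DecidableEq U] {f : Finset U → ℝ}
    (hmono : IsMonotoneFn f) (hsub : IsSubmodular f) {T : ℕ} {P G : Fin T → Finset U}
    (hsel : ∀ t : Fin T,
      marg f (P t) (prefUnion P (t : ℕ)) ≥ marg f (G t) (prefUnion P (t : ℕ)))
    {Q : Finset U} (hQ : Finset.univ.biUnion P ⊆ Q) (n : ℕ) (hn : n ≤ T) :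
    marg f (prefUnion G n) Q ≤ f (prefUnion P n) - f ∅ := by
  induction n with
  | zero => simp [marg, prefUnion_zero]
  | succ n ih =>
    have hG := prefUnion_succ G ⟨n, hn⟩
    have hP := prefUnion_succ P ⟨n, hn⟩
    have hs := hsel ⟨n, hn⟩
    have ha := marg_anti hmono hsub (G ⟨n, hn⟩)
      (((prefUnion_subset_biUnion_univ P n).trans hQ).trans
        (Finset.subset_union_right : Q ⊆ prefUnion G n ∪ Q))
    have hi := ih (Nat.le_of_succ_le hn)
    simp only [marg] at *
    rw [hG, hP, Finset.union_assoc]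
    linarith

/-- Half-of-best-guess lemma (Lemma 3 of the paper). If at each
step `t` the marginal gain of `P^t` over `⋃_{s<t} P^s` is at least that of
`G^t`, then `f(⋃_{t=1}^T P^t) ≥ (1/2) * f(⋃_{t=1}^T G^t)`. -/
theorem half_of_best_guess {U : Type*} [Fintype U] [DecidableEq U]
    (f : Finset U → ℝ) (hnonneg : ∀ A : Finset U, 0 ≤ f A)
    (hmono : IsMonotoneFn f) (hsub : IsSubmodular f)
    (T : ℕ) (hT : 1 ≤ T) (P G : Fin T → Finset U)
    (hsel : ∀ t : Fin T,
      marg f (P t) (prefUnion P (t : ℕ)) ≥ marg f (G t) (prefUnion P (t : ℕ))) :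
    f (Finset.univ.biUnion P) ≥ (1 / 2 : ℝ) * f (Finset.univ.biUnion G) := by
  have h := marg_prefUnion_le hmono hsub hsel subset_rfl T le_rfl
  rw [prefUnion_eq_biUnion_univ, prefUnion_eq_biUnion_univ, marg] at h
  linarith [hnonneg ∅, hmono _ _ (Finset.subset_union_left :
    Finset.univ.biUnion G ⊆ Finset.univ.biUnion G ∪ Finset.univ.biUnion P)]
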